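/- Untestability of MAR with a single partially observed variable (only-if direction of Theorem 6): let X be a nonempty finite type (the single partially observed variable, with missingness indicator R_X) and V a nonempty finite type (the fully observed variables). For every probability measure Q on Option X × V × Bool (coordinates X*, V_o, R_X) such that Q-almost surely X* = none if and only if R_X = 1, and such that Q assigns positive probability to every point consistent with this constraint, there exists a probability measure P on X × V × Bool under which X is conditionally independent of R_X given V (the MAR condition) and whose pushforward under the masking map (x, v, r) ↦ ((if r = 0 then some x else none), v, r) equals Q. Hence when only one variable is partially observed, MAR has no testable implications. -/

import Mathlib

open MeasureTheory

/-- Elementary conditional probability `P(A | B)`. -/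
noncomputable def cpr {Ω : Type*} [MeasurableSpace Ω] (P : Measure Ω) (A B : Set Ω) : ENNReal :=
  P (A ∩ B) / P B

/-- Discrete σ-algebra on `Option α`. -/
instance {α : Type*} : MeasurableSpace (Option α) := ⊤

/-- The masking map `(x, v, r) ↦ ((if r = 0 then some x else none), v, r)`; `r = false`
means observed (`R = 0`), `r = true` means missing (`R = 1`). -/
def mask {X V : Type*} (p : X × V × Bool) : Option X × V × Bool :=
  ((if p.2.2 = false then some p.1 else none), p.2.1, p.2.2)

open scoped Classical in
lemma sum_smul_dirac_apply_eq {Ω : Type*} [Fintype Ω] [MeasurableSpace Ω]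
    [MeasurableSingletonClass Ω] (w : Ω → ENNReal) (S : Set Ω) :
    (∑ p, w p • Measure.dirac p) S = ∑ p, if p ∈ S then w p else 0 := by
  simp [Measure.finsetSum_apply, Set.indicator_apply]

/-- The weights `m x v * c v r`, with each `m · v` summing to one, make `X` conditionally
independent of `R` given `V`. -/
lemma cpr_inter_eq_mul_of_factorization {X V : Type*} [Fintype X] [Fintype V]
    [MeasurableSpace X] [MeasurableSingletonClass X]
    [MeasurableSpace V] [MeasurableSingletonClass V]
    (m : X → V → ENNReal) (c : V → Bool → ENNReal) (hm : ∀ v, ∑ x, m x v = 1)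
    (hc₀ : ∀ v, ∑ r, c v r ≠ 0) (hc : ∀ v, ∑ r, c v r ≠ ⊤) (x : X) (r : Bool) (v : V)
    (P : Measure (X × V × Bool))
    (hP : P = ∑ p : X × V × Bool, (m p.1 p.2.1 * c p.2.1 p.2.2) • Measure.dirac p) :
    cpr P ({p | p.1 = x} ∩ {p | p.2.2 = r}) {p | p.2.1 = v} =
      cpr P {p | p.1 = x} {p | p.2.1 = v} * cpr P {p | p.2.2 = r} {p | p.2.1 = v} := by
  classical
  have hV : P {p | p.2.1 = v} = ∑ r, c v r := by
    rw [hP, sum_smul_dirac_apply_eq]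
    simp only [Fintype.sum_prod_type, Set.mem_ofPred_eq, ← Finset.mul_sum,
      Finset.sum_ite_irrel, Finset.sum_const_zero, Finset.sum_ite_eq', Finset.mem_univ,
      if_true, ← Finset.sum_mul, hm, one_mul]
  have hXV : P ({p | p.1 = x} ∩ {p | p.2.1 = v}) = m x v * ∑ r, c v r := by
    rw [hP, sum_smul_dirac_apply_eq]
    simp only [Fintype.sum_prod_type, Set.mem_inter_iff, Set.mem_ofPred_eq, ite_and,
      Finset.sum_ite_irrel, Finset.sum_const_zero, Finset.sum_ite_eq', Finset.mem_univ,
      if_true, Finset.mul_sum]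
  have hRV : P ({p | p.2.2 = r} ∩ {p | p.2.1 = v}) = c v r := by
    rw [hP, sum_smul_dirac_apply_eq]
    simp only [Fintype.sum_prod_type, Set.mem_inter_iff, Set.mem_ofPred_eq, ite_and,
      Finset.sum_ite_eq', Finset.mem_univ, if_true, ← Finset.sum_mul, hm, one_mul]
  have hXRV : P ({p | p.1 = x} ∩ {p | p.2.2 = r} ∩ {p | p.2.1 = v}) = m x v * c v r := by
    rw [hP, sum_smul_dirac_apply_eq]
    simp only [Fintype.sum_prod_type, Set.mem_inter_iff, Set.mem_ofPred_eq, ite_and,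
      Finset.sum_ite_irrel, Finset.sum_const_zero, Finset.sum_ite_eq', Finset.mem_univ,
      if_true]
  simp only [cpr, hV, hXV, hRV, hXRV]
  rw [ENNReal.mul_div_cancel_right (hc₀ v) (hc v), mul_div_assoc]

/-- **Untestability of MAR with a single partially observed variable (Theorem 6,
only-if direction).**  `X` is the single partially observed variable (indicator `R_X`)
and `V` holds the fully observed variables.  For every observed-data distribution `Q` on
`X* × V × R_X` consistent with the masking (a.s. `X* = none ↔ R_X = 1`) that puts
positive mass on every consistent point, there is an underlying distribution `P` on
`X × V × R_X` satisfying MAR, i.e. `X ⟂ R_X | V`, whose masked distribution is exactly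
`Q`.  Hence with one partially observed variable MAR has no testable implications. -/
theorem mar_untestable_single_variable
    {X V : Type*} [Fintype X] [Nonempty X] [Fintype V] [Nonempty V]
    [MeasurableSpace X] [MeasurableSingletonClass X]
    [MeasurableSpace V] [MeasurableSingletonClass V]
    (Q : Measure (Option X × V × Bool)) [IsProbabilityMeasure Q]
    -- Q-a.s., X* = none iff R_X = 1:
    (hae : Q {q | ¬ (q.1 = none ↔ q.2.2 = true)} = 0)
    -- positive probability on every point consistent with the masking:
    (hpos : ∀ q : Option X × V × Bool, (q.1 = none ↔ q.2.2 = true) → 0 < Q {q}) :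
    ∃ P : Measure (X × V × Bool), IsProbabilityMeasure P ∧
      -- MAR: X is conditionally independent of R_X given V under P:
      (∀ (x : X) (r : Bool) (v : V),
        cpr P ({p | p.1 = x} ∩ {p | p.2.2 = r}) {p | p.2.1 = v} =
          cpr P {p | p.1 = x} {p | p.2.1 = v} *
            cpr P {p | p.2.2 = r} {p | p.2.1 = v}) ∧
      P.map mask = Q := by
  classical
  let s : V → ENNReal := fun v => ∑ x, Q {(some x, v, false)}
  let m : X → V → ENNReal := fun x v => Q {(some x, v, false)} / s v
  let c : V → Bool → ENNReal := fun v r => if r then Q {(none, v, true)} else s v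
  have hs_top (v : V) : s v ≠ ⊤ := ENNReal.sum_ne_top.2 fun x _ => measure_ne_top Q _
  have hs_pos (v : V) : s v ≠ 0 := fun h =>
    (hpos (some (Classical.arbitrary X), v, false) (by simp)).ne'
      (Finset.sum_eq_zero_iff.1 h _ (Finset.mem_univ _))
  have hm (v : V) : ∑ x, m x v = 1 := by
    simp only [m, div_eq_mul_inv, ← Finset.sum_mul]
    exact ENNReal.mul_inv_cancel (hs_pos v) (hs_top v)
  let P : Measure (X × V × Bool) :=
    ∑ p : X × V × Bool, (m p.1 p.2.1 * c p.2.1 p.2.2) • Measure.dirac p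
  have hmask : Measurable (mask : X × V × Bool → Option X × V × Bool) :=
    measurable_of_countable _
  have : MeasurableSingletonClass (Option X) := ⟨fun _ => trivial⟩
  have hmap : P.map mask = Q := by
    refine Measure.ext_of_singleton fun q => ?_
    rw [Measure.map_apply hmask (measurableSet_singleton q), sum_smul_dirac_apply_eq]
    by_cases hq : q.1 = none ↔ q.2.2 = true
    · obtain ⟨_ | x, v, _ | _⟩ := q
      · simp at hq
      · simp [Fintype.sum_prod_type, mask, c, ite_and, ← Finset.sum_mul, hm]
      · simp [Fintype.sum_prod_type, mask, c, m, ite_and, Finset.sum_ite_irrel,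
          ENNReal.div_mul_cancel (hs_pos v) (hs_top v)]
      · simp at hq
    · rw [measure_mono_null (Set.singleton_subset_iff.2 hq) hae]
      refine Finset.sum_eq_zero fun p _ => if_neg ?_
      rintro rfl
      obtain ⟨x, v, _ | _⟩ := p <;> simp [mask] at hq
  refine ⟨P, ⟨?_⟩, fun x r v => ?_, hmap⟩
  · rw [← Set.preimage_univ (f := mask), ← Measure.map_apply hmask .univ, hmap, measure_univ]
  · refine cpr_inter_eq_mul_of_factorization m c hm (fun v => ?_) (fun v => ?_) x r v P rfl
    · simp [c, hs_pos v]
    · simp [c, hs_top v]
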